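/- arXiv:2304.06293 — 3 statements merged into one kernel-verified Lean document; each statement's English description precedes it below -/
import Mathlib

section
/- Let T > 0 and let a ∈ L¹(0,T) be completely positive. Let f : ℝ → ℝ be continuously differentiable, u₀ ∈ ℝ, and let u be absolutely continuous on [0, T_b) (0 < T_b ≤ T) with u(t) = u₀ + ∫₀ᵗ a(t−s) f(u(s)) ds for all t ∈ [0, T_b). Then u is monotone on [0, T_b): nondecreasing if f(u₀) ≥ 0 and nonincreasing if f(u₀) ≤ 0. -/
open MeasureTheory Set

/-- `r` is the resolvent kernel of `a ∈ L¹(0,T)` for parameter `λ`: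
`r(t) + λ ∫₀ᵗ r(t−s) a(s) ds = λ a(t)` for a.e. `t ∈ (0,T)`. -/
def IsResolventKernel (a r : ℝ → ℝ) (T lam : ℝ) : Prop :=
  IntegrableOn r (Ioc 0 T) ∧
  ∀ᵐ t ∂(volume.restrict (Ioc (0:ℝ) T)),
    r t + lam * ∫ s in (0:ℝ)..t, r (t - s) * a s = lam * a t

/-- `a` is completely positive on `[0,T]`: for every `λ > 0` the resolvent `r_λ` exists,
is nonnegative a.e., and `s_λ(t) = 1 − ∫₀ᵗ r_λ ≥ 0` on `[0,T]`. -/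
def CompletelyPositive (a : ℝ → ℝ) (T : ℝ) : Prop :=
  ∀ lam : ℝ, 0 < lam → ∃ r : ℝ → ℝ, IsResolventKernel a r T lam ∧
    (∀ᵐ t ∂(volume.restrict (Ioc (0:ℝ) T)), 0 ≤ r t) ∧
    ∀ t ∈ Icc (0:ℝ) T, 0 ≤ 1 - ∫ τ in (0:ℝ)..t, r τ

lemma integrable_indicator_Icc_of_integrableOn_Ioc {g : ℝ → ℝ} {b c : ℝ}
    (hg : IntegrableOn g (Ioc b c)) : Integrable ((Icc b c).indicator g) :=
  (integrable_indicator_iff measurableSet_Icc).2 ((integrableOn_Icc_iff_integrableOn_Ioc).2 hg)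

lemma measurable_indicator_Icc_of_continuousOn {g : ℝ → ℝ} {b c : ℝ}
    (hg : ContinuousOn g (Icc b c)) : Measurable ((Icc b c).indicator g) := by
  classical
  rw [← Set.piecewise_eq_indicator]
  exact hg.measurable_piecewise continuousOn_const measurableSet_Icc

lemma exists_abs_indicator_Icc_le {g : ℝ → ℝ} {b c : ℝ} (hg : ContinuousOn g (Icc b c)) :
    ∃ C, ∀ x, |(Icc b c).indicator g x| ≤ C := by
  obtain ⟨C, hC⟩ := isCompact_Icc.exists_bound_of_continuousOn hg
  refine ⟨max C 0, fun x => ?_⟩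
  by_cases hx : x ∈ Icc b c
  · rw [indicator_of_mem hx]
    exact (hC x hx).trans (le_max_left _ _)
  · simp [indicator_of_notMem hx]

lemma integrable_mul_comp_sub_left {K g : ℝ → ℝ} {C : ℝ} (hK : Integrable K)
    (hg : AEStronglyMeasurable g) (hC : ∀ x, |g x| ≤ C) (t : ℝ) :
    Integrable fun s => K s * g (t - s) :=
  hK.mul_bdd (c := C)
    (hg.comp_quasiMeasurePreserving (quasiMeasurePreserving_sub_left_of_right_invariant volume t))
    (ae_of_all _ fun s => hC (t - s))

lemma exists_integral_exp_mul_lt_one {K : ℝ → ℝ} (hK : Integrable K)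
    (hK0 : ∀ s < 0, K s = 0) : ∃ σ : ℝ, (Integrable fun s => Real.exp (-(σ * s)) * K s) ∧
      ∫ s, Real.exp (-(σ * s)) * K s < 1 := by
  have hm : ∀ n : ℕ, AEStronglyMeasurable fun s => Real.exp (-((n : ℝ) * s)) * K s := fun n =>
    (by fun_prop : Continuous fun s : ℝ => Real.exp (-((n : ℝ) * s))).aestronglyMeasurable.mul
      hK.aestronglyMeasurable
  have hb : ∀ n : ℕ, ∀ᵐ s : ℝ, ‖Real.exp (-((n : ℝ) * s)) * K s‖ ≤ ‖K s‖ := by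
    refine fun n => ae_of_all _ fun s => ?_
    rcases lt_or_ge s 0 with hs | hs
    · simp [hK0 s hs]
    · rw [norm_mul, Real.norm_eq_abs, Real.abs_exp]
      exact mul_le_of_le_one_left (norm_nonneg _) (Real.exp_le_one_iff.2 (by
        have : (0:ℝ) ≤ n * s := by positivity
        linarith))
  have hlim := tendsto_integral_of_dominated_convergence (f := fun _ => (0 : ℝ))
    (fun s => ‖K s‖) hm hK.norm hb (by
      have hne : ∀ᵐ s : ℝ, s ≠ 0 := by simp [ae_iff]
      filter_upwards [hne] with s hs
      rcases lt_or_gt_of_ne hs with hs | hs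
      · simp [hK0 s hs]
      · rw [← zero_mul (K s)]
        refine Filter.Tendsto.mul_const _ (Real.tendsto_exp_neg_atTop_nhds_zero.comp ?_)
        exact tendsto_natCast_atTop_atTop.atTop_mul_const hs)
  rw [integral_zero] at hlim
  obtain ⟨n, hn⟩ := (hlim.eventually (gt_mem_nhds one_pos)).exists
  exact ⟨n, hK.mono (hm n) (hb n), hn⟩

/-- A nonnegative subsolution of a linear homogeneous Volterra inequality vanishes. -/
lemma eq_zero_of_le_integral_mul {K P : ℝ → ℝ} {b : ℝ} (hK : Integrable K)
    (hKnn : ∀ᵐ s, 0 ≤ K s) (hK0 : ∀ s < 0, K s = 0) (hPc : ContinuousOn P (Icc 0 b))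
    (hPnn : ∀ t, 0 ≤ P t) (hP0 : ∀ t < 0, P t = 0)
    (hP : ∀ t ∈ Icc 0 b, P t ≤ ∫ s, K s * P (t - s)) : ∀ t ∈ Icc 0 b, P t = 0 := by
  intro t ht
  obtain ⟨σ, hσi, hσ⟩ := exists_integral_exp_mul_lt_one hK hK0
  obtain ⟨x, hx, hmax⟩ := isCompact_Icc.exists_isMaxOn (f := fun x => Real.exp (-(σ * x)) * P x)
    ⟨t, ht⟩ (ContinuousOn.mul (by fun_prop) hPc)
  set M := Real.exp (-(σ * x)) * P x with hM
  have hMnn : 0 ≤ M := mul_nonneg (Real.exp_nonneg _) (hPnn x)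
  have hle : ∀ y ≤ b, Real.exp (-(σ * y)) * P y ≤ M := fun y hy => by
    rcases lt_or_ge y 0 with hy0 | hy0
    · simpa [hP0 y hy0] using hMnn
    · exact hmax ⟨hy0, hy⟩
  have hexp : ∀ y, P y = Real.exp (σ * y) * (Real.exp (-(σ * y)) * P y) := fun y => by
    rw [← mul_assoc, ← Real.exp_add]; simp
  have hbound : P x ≤ ∫ s, Real.exp (σ * x) * M * (Real.exp (-(σ * s)) * K s) := by
    refine (hP x hx).trans (integral_mono_of_nonneg ?_ (hσi.const_mul _) ?_)
    · filter_upwards [hKnn] with s hs using mul_nonneg hs (hPnn _)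
    · filter_upwards [hKnn] with s hs
      rcases lt_or_ge s 0 with hs0 | hs0
      · simp [hK0 s hs0]
      · have h1 := hle (x - s) (by linarith [hx.2])
        have h2 : Real.exp (σ * (x - s)) = Real.exp (σ * x) * Real.exp (-(σ * s)) := by
          rw [← Real.exp_add]; ring_nf
        calc K s * P (x - s)
            = K s * (Real.exp (σ * (x - s)) * (Real.exp (-(σ * (x - s))) * P (x - s))) := by
              rw [← hexp]
          _ ≤ K s * (Real.exp (σ * (x - s)) * M) := by gcongr
          _ = _ := by rw [h2]; ring
  rw [integral_const_mul] at hbound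
  have hM0 : M = 0 := by
    have h3 : M ≤ M * ∫ s, Real.exp (-(σ * s)) * K s := by
      calc M ≤ Real.exp (-(σ * x)) * (Real.exp (σ * x) * M * ∫ s, Real.exp (-(σ * s)) * K s) := by
            rw [hM]; gcongr
        _ = (Real.exp (-(σ * x)) * Real.exp (σ * x)) * (M * ∫ s, Real.exp (-(σ * s)) * K s) := by
            ring
        _ = _ := by rw [← Real.exp_add]; simp
    nlinarith
  have h4 := hle t ht.2
  rw [hM0] at h4
  rw [hexp t, le_antisymm h4 (mul_nonneg (Real.exp_nonneg _) (hPnn t)), mul_zero]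

lemma integral_indicator_mul_indicator_sub (p q : ℝ → ℝ) {T b x : ℝ} (hx0 : 0 ≤ x) (hxT : x ≤ T)
    (hxb : x ≤ b) : ∫ s, (Icc 0 T).indicator p s * (Icc 0 b).indicator q (x - s)
      = ∫ s in (0:ℝ)..x, p s * q (x - s) := by
  rw [intervalIntegral.integral_of_le hx0, ← integral_Icc_eq_integral_Ioc,
    ← integral_indicator measurableSet_Icc]
  congr 1
  ext s
  by_cases hs : s ∈ Icc 0 x
  · rw [indicator_of_mem hs, indicator_of_mem (show s ∈ Icc 0 T from ⟨hs.1, hs.2.trans hxT⟩),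
      indicator_of_mem (show x - s ∈ Icc 0 b from ⟨by linarith [hs.2], by linarith [hs.1]⟩)]
  · rw [indicator_of_notMem hs]
    by_cases hs0 : 0 ≤ s
    · rw [indicator_of_notMem (s := Icc 0 b) (fun h => hs ⟨hs0, by linarith [h.1]⟩), mul_zero]
    · rw [indicator_of_notMem (s := Icc 0 T) (fun h => hs0 h.1), zero_mul]

lemma integral_mul_integral_sub_assoc {R A Φ : ℝ → ℝ} {C : ℝ} (hR : Integrable R)
    (hA : Integrable A) (hΦ : Integrable Φ) (hC : ∀ x, |Φ x| ≤ C) (t : ℝ) :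
    ∫ s, (∫ q, R q * A (s - q)) * Φ (t - s) = ∫ s, R s * ∫ q, A q * Φ (t - s - q) := by
  have hC' : ∀ x, |‖Φ x‖| ≤ C := by simpa using hC
  have hAΦ := hA.norm.integrable_convolution (ContinuousLinearMap.mul ℝ ℝ) hΦ.norm
  refine convolution_assoc (ContinuousLinearMap.mul ℝ ℝ) (ContinuousLinearMap.mul ℝ ℝ)
    (ContinuousLinearMap.mul ℝ ℝ) (ContinuousLinearMap.mul ℝ ℝ) (fun x y z => mul_assoc x y z)
    hR.aestronglyMeasurable hA.aestronglyMeasurable hΦ.aestronglyMeasurable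
    (hR.ae_convolution_exists _ hA)
    (ae_of_all _ fun x => integrable_mul_comp_sub_left hA.norm hΦ.aestronglyMeasurable.norm hC' x)
    (integrable_mul_comp_sub_left (C := (∫ s, ‖A s‖) * C) hR.norm
      hAΦ.aestronglyMeasurable (fun x => ?_) t)
  change ‖∫ s, ‖A s‖ * ‖Φ (x - s)‖‖ ≤ _
  rw [← integral_mul_const]
  refine norm_integral_le_of_norm_le (hA.norm.mul_const C) (ae_of_all _ fun s => ?_)
  simpa using mul_le_mul_of_nonneg_left (hC (x - s)) (abs_nonneg (A s))

/-- Convolving with the resolvent kernel removes the linear term from a Volterra equation. -/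
lemma IsResolventKernel.eq_integral {a r w φ : ℝ → ℝ} {T lam b : ℝ}
    (hr : IsResolventKernel a r T lam) (hlam : 0 < lam) (ha : IntegrableOn a (Ioc 0 T))
    (hbT : b ≤ T) (hφ : ContinuousOn φ (Icc 0 b)) (hwc : ContinuousOn w (Icc 0 b))
    (hw : ∀ t ∈ Icc 0 b, w t = ∫ s in (0:ℝ)..t, a (t - s) * φ s) :
    ∀ t ∈ Icc 0 b, w t = ∫ s, (Icc 0 T).indicator r s *
      (Icc 0 b).indicator (fun x => w x + lam⁻¹ * φ x) (t - s) := by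
  intro t ht
  set A := (Icc 0 T).indicator a with hAdef
  set R := (Icc 0 T).indicator r with hRdef
  set Φ := (Icc 0 b).indicator φ with hΦdef
  set W := (Icc 0 b).indicator w with hWdef
  have hA : Integrable A := integrable_indicator_Icc_of_integrableOn_Ioc ha
  have hR : Integrable R := integrable_indicator_Icc_of_integrableOn_Ioc hr.1
  have hΦm := (measurable_indicator_Icc_of_continuousOn hφ).aestronglyMeasurable (μ := volume)
  have hWm := (measurable_indicator_Icc_of_continuousOn hwc).aestronglyMeasurable (μ := volume)
  obtain ⟨C, hC⟩ := exists_abs_indicator_Icc_le hφ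
  obtain ⟨D, hD⟩ := exists_abs_indicator_Icc_le hwc
  have hAΦ : ∀ x ≤ b, ∫ s, A s * Φ (x - s) = W x := by
    intro x hx
    rcases lt_or_ge x 0 with hx0 | hx0
    · rw [hWdef, indicator_of_notMem (fun h => hx0.not_ge h.1)]
      refine (integral_congr_ae (ae_of_all _ fun s => ?_)).trans (integral_zero ℝ ℝ)
      by_cases hs : 0 ≤ s
      · simp [hΦdef, indicator_of_notMem (s := Icc 0 b) (a := x - s) (fun h => by linarith [h.1])]
      · simp [hAdef, indicator_of_notMem (s := Icc 0 T) (a := s) (fun h => hs h.1)]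
    · rw [hWdef, indicator_of_mem (show x ∈ Icc 0 b from ⟨hx0, hx⟩), hw x ⟨hx0, hx⟩,
        integral_indicator_mul_indicator_sub a φ hx0 (hx.trans hbT) hx]
      have := intervalIntegral.integral_comp_sub_left (a := 0) (b := x)
        (fun s => a (x - s) * φ s) x
      simpa using this
  have hassoc := integral_mul_integral_sub_assoc hR hA
    ((integrable_indicator_iff measurableSet_Icc).2 hφ.integrableOn_Icc) hC t
  have hright : ∫ s, R s * ∫ q, A q * Φ (t - s - q) = ∫ s, R s * W (t - s) := by
    refine integral_congr_ae (ae_of_all _ fun s => ?_)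
    by_cases hs : 0 ≤ s
    · simp only [hAΦ (t - s) (by linarith [ht.2])]
    · simp [hRdef, indicator_of_notMem (s := Icc 0 T) (a := s) (fun h => hs h.1)]
  have hres : ∀ᵐ s, s ∈ Icc 0 T → R s + lam * ∫ q, R q * A (s - q) = lam * A s := by
    have := hr.2
    rw [restrict_Ioc_eq_restrict_Icc, ae_restrict_iff' measurableSet_Icc] at this
    filter_upwards [this] with s hs hsT
    rw [integral_indicator_mul_indicator_sub r a hsT.1 hsT.2 hsT.2, hRdef, hAdef,
      indicator_of_mem hsT, indicator_of_mem hsT, ← hs hsT]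
    have := intervalIntegral.integral_comp_sub_left (a := 0) (b := s)
      (fun q => r (s - q) * a q) s
    simp only [sub_sub_cancel, sub_self, sub_zero] at this
    rw [this]
  have hleft : ∫ s, (∫ q, R q * A (s - q)) * Φ (t - s)
      = ∫ s, (A s * Φ (t - s) - lam⁻¹ * (R s * Φ (t - s))) := by
    refine integral_congr_ae ?_
    filter_upwards [hres] with s hs
    by_cases hs0 : 0 ≤ s
    · by_cases hst : s ≤ t
      · have h := hs ⟨hs0, by linarith [ht.2]⟩
        have h' : ∫ q, R q * A (s - q) = A s - lam⁻¹ * R s := by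
          field_simp
          linarith
        rw [h']; ring
      · simp [hΦdef, indicator_of_notMem (s := Icc 0 b) (a := t - s) (fun h => by linarith [h.1])]
    · have h0 : ∫ q, R q * A (s - q) = 0 := by
        refine (integral_congr_ae (ae_of_all _ fun q => ?_)).trans (integral_zero ℝ ℝ)
        by_cases hq : 0 ≤ q
        · simp [hAdef, indicator_of_notMem (s := Icc 0 T) (a := s - q)
            (fun h => by linarith [h.1])]
        · simp [hRdef, indicator_of_notMem (s := Icc 0 T) (a := q) (fun h => hq h.1)]
      have hn : s ∉ Icc 0 T := fun h => hs0 h.1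
      rw [h0, hAdef, hRdef, indicator_of_notMem hn, indicator_of_notMem hn]; ring
  have hRΦ := integrable_mul_comp_sub_left hR hΦm hC t
  have hRW := integrable_mul_comp_sub_left hR hWm hD t
  rw [hleft, hright, integral_sub (integrable_mul_comp_sub_left hA hΦm hC t) (hRΦ.const_mul _),
    hAΦ t ht.2, integral_const_mul, hWdef, indicator_of_mem ht, ← hWdef] at hassoc
  have hsum : ∫ s, R s * (Icc 0 b).indicator (fun x => w x + lam⁻¹ * φ x) (t - s)
      = ∫ s, (R s * W (t - s) + lam⁻¹ * (R s * Φ (t - s))) := by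
    refine integral_congr_ae (ae_of_all _ fun s => ?_)
    by_cases h : t - s ∈ Icc 0 b
    · simp only [hWdef, hΦdef, indicator_of_mem h]; ring
    · simp [hWdef, hΦdef, indicator_of_notMem h]
  rw [hsum, integral_add hRW (hRΦ.const_mul _), integral_const_mul]
  linarith

/-- Solutions of `w = R * G(w)` on `[0, b]` with a nonnegative kernel `R`, and with `g = G(w)`
nondecreasing and Lipschitz along `w`, are nondecreasing if `0 ≤ g 0`. -/
lemma le_of_eq_integral_mul {R w g : ℝ → ℝ} {b L : ℝ} (hR : Integrable R)
    (hRnn : ∀ᵐ s, 0 ≤ R s) (hR0 : ∀ s < 0, R s = 0) (hL : 0 ≤ L)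
    (hwc : ContinuousOn w (Icc 0 b)) (hgc : ContinuousOn g (Icc 0 b))
    (hg : ∀ x ∈ Icc 0 b, ∀ y ∈ Icc 0 b, g x - g y ≤ L * max 0 (w x - w y))
    (hg0 : 0 ≤ g 0) (hw0 : w 0 = 0)
    (hw : ∀ t ∈ Icc 0 b, w t = ∫ s, R s * (Icc 0 b).indicator g (t - s))
    {x : ℝ} (hx : x ∈ Icc 0 b) : w x ≤ w b := by
  set G := (Icc 0 b).indicator g with hG
  have hGm := (measurable_indicator_Icc_of_continuousOn hgc).aestronglyMeasurable (μ := volume)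
  obtain ⟨C, hC⟩ := exists_abs_indicator_Icc_le hgc
  have hGi := integrable_mul_comp_sub_left hR hGm hC
  have hb : (0:ℝ) ∈ Icc 0 b := ⟨le_rfl, hx.1.trans hx.2⟩
  have key : ∀ (c : ℝ) (p v : ℝ → ℝ), ContinuousOn p (Icc 0 c) →
      (∀ t ∈ Icc 0 c, p t = ∫ s, v (t - s) * R s) →
      (∀ t ∈ Icc 0 c, Integrable fun s => v (t - s) * R s) →
      (∀ y ≤ c, v y ≤ L * (Icc 0 c).indicator (fun y => max 0 (p y)) y) →
      ∀ t ∈ Icc 0 c, p t ≤ 0 := by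
    intro c p v hpc hp hvi hv t ht
    have hqc : ContinuousOn (fun y => max 0 (p y)) (Icc 0 c) := continuousOn_const.sup hpc
    set P := (Icc 0 c).indicator (fun y => max 0 (p y)) with hP
    have hPnn : ∀ y, 0 ≤ P y := indicator_nonneg fun y _ => le_max_left _ _
    obtain ⟨D, hD⟩ := exists_abs_indicator_Icc_le hqc
    have hLR : Integrable fun s => L * R s := hR.const_mul L
    have hLRnn : ∀ᵐ s, 0 ≤ L * R s := by filter_upwards [hRnn] with s hs using mul_nonneg hL hs
    have hzero := eq_zero_of_le_integral_mul (P := P) (b := c) hLR hLRnn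
      (fun s hs => by simp [hR0 s hs])
      (hqc.congr fun y hy => indicator_of_mem hy _) hPnn
      (fun y hy => indicator_of_notMem (fun h => hy.not_ge h.1) _) (fun y hy => ?_) t ht
    · rw [hP, indicator_of_mem ht] at hzero
      exact (le_max_right _ _).trans hzero.le
    · rw [hP, indicator_of_mem hy, ← hP]
      refine max_le (integral_nonneg_of_ae ?_) ?_
      · filter_upwards [hLRnn] with s hs using mul_nonneg hs (hPnn _)
      · rw [hp y hy]
        refine integral_mono_ae (hvi y hy) (integrable_mul_comp_sub_left hLR
          (measurable_indicator_Icc_of_continuousOn hqc).aestronglyMeasurable hD y) ?_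
        filter_upwards [hRnn] with s hs
        rcases lt_or_ge s 0 with hs0 | hs0
        · simp [hR0 s hs0]
        · nlinarith [mul_le_mul_of_nonneg_right (hv (y - s) (by linarith [hy.2])) hs]
  have hwnn : ∀ t ∈ Icc 0 b, 0 ≤ w t := by
    intro t ht
    have := key b (fun t => -w t) (fun y => -G y) hwc.neg (fun t ht => ?_) (fun t _ => ?_)
      (fun y hy => ?_) t ht
    · simpa using this
    · rw [hw t ht, ← integral_neg]; congr 1; ext s; ring
    · simpa [mul_comm] using (hGi t).neg
    · by_cases h : y ∈ Icc 0 b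
      · have := hg 0 hb y h
        rw [hw0, zero_sub] at this
        simp only [hG, indicator_of_mem h]
        linarith
      · simp [hG, indicator_of_notMem h]
  have hGnn : ∀ y, 0 ≤ G y := indicator_nonneg fun y hy => by
    have := hg 0 hb y hy
    rw [hw0, zero_sub, max_eq_left (by linarith [hwnn y hy])] at this
    linarith
  have hmem : ∀ t ∈ Icc 0 x, t ∈ Icc 0 b ∧ t + (b - x) ∈ Icc 0 b := fun t ht =>
    ⟨⟨ht.1, ht.2.trans hx.2⟩, by linarith [ht.1, hx.2], by linarith [ht.2]⟩
  have := key x (fun t => w t - w (t + (b - x))) (fun y => G y - G (y + (b - x)))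
    ((hwc.mono fun t ht => (hmem t ht).1).sub
      (hwc.comp (by fun_prop) fun t ht => (hmem t ht).2)) (fun t ht => ?_) (fun t _ => ?_)
    (fun y hy => ?_) x ⟨hx.1, le_rfl⟩
  · simpa using this
  · rw [hw t (hmem t ht).1, hw _ (hmem t ht).2, ← integral_sub (hGi _) (hGi _)]
    congr 1; ext s
    rw [show t + (b - x) - s = t - s + (b - x) by ring]; ring
  · have := (hGi t).sub (hGi (t + (b - x)))
    refine this.congr (ae_of_all _ fun s => ?_)
    simp only [Pi.sub_apply]
    rw [show t + (b - x) - s = t - s + (b - x) by ring]; ring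
  · by_cases h : y ∈ Icc 0 x
    · have := hg y (hmem y h).1 _ (hmem y h).2
      simpa only [hG, indicator_of_mem h, indicator_of_mem (hmem y h).1,
        indicator_of_mem (hmem y h).2] using this
    · have h0 : G y = 0 := indicator_of_notMem (fun h' => h ⟨h'.1, hy⟩) _
      rw [indicator_of_notMem h, h0]
      linarith [hGnn (y + (b - x))]

lemma CompletelyPositive.monotoneOn_of_volterra {a f u : ℝ → ℝ} {T Tb u₀ : ℝ} (hTbT : Tb ≤ T)
    (ha : IntegrableOn a (Ioc 0 T)) (hacp : CompletelyPositive a T) (hf : LocallyLipschitz f)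
    (huc : ContinuousOn u (Ico 0 Tb))
    (hu : ∀ t ∈ Ico (0:ℝ) Tb, u t = u₀ + ∫ s in (0:ℝ)..t, a (t - s) * f (u s))
    (hf0 : 0 ≤ f u₀) : MonotoneOn u (Ico 0 Tb) := by
  intro x hx b hb hxb
  have hsub : Icc 0 b ⊆ Ico 0 Tb := fun t ht => ⟨ht.1, ht.2.trans_lt hb.2⟩
  have hub : ContinuousOn u (Icc 0 b) := huc.mono hsub
  have hfu : ContinuousOn (fun t => f (u t)) (Icc 0 b) := hf.continuous.comp_continuousOn hub
  have hu0 : u 0 = u₀ := by simpa using hu 0 (hsub ⟨le_rfl, hb.1⟩)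
  obtain ⟨M, hM⟩ := (hf.locallyLipschitzOn (s := u '' Icc 0 b)).exists_lipschitzOnWith_of_compact
    (isCompact_Icc.image_of_continuousOn hub)
  have hlam : (0:ℝ) < M + 1 := by positivity
  obtain ⟨r, hr, hrnn, -⟩ := hacp (M + 1) hlam
  have hwc : ContinuousOn (fun t => u t - u₀) (Icc 0 b) := hub.sub continuousOn_const
  have hrep := hr.eq_integral hlam ha (hb.2.le.trans hTbT) hfu hwc
    (fun t ht => by rw [hu t (hsub ht)]; ring)
  have := le_of_eq_integral_mul (L := 1 + (M + 1 : ℝ)⁻¹ * M)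
    (w := fun t => u t - u₀) (g := fun t => u t - u₀ + (M + 1 : ℝ)⁻¹ * f (u t))
    (integrable_indicator_Icc_of_integrableOn_Ioc hr.1)
    (by
      rw [restrict_Ioc_eq_restrict_Icc, ae_restrict_iff' measurableSet_Icc] at hrnn
      filter_upwards [hrnn] with s hs
      exact indicator_apply_nonneg hs)
    (fun s hs => indicator_of_notMem (fun h => hs.not_ge h.1) _) (by positivity) hwc
    (hwc.add (continuousOn_const.mul hfu)) ?_ (by
      simp only [hu0, sub_self, zero_add]
      exact mul_nonneg (inv_nonneg.2 hlam.le) hf0)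
    (by simp [hu0]) hrep ⟨hx.1, hxb⟩
  · simpa using this
  · intro p hp q hq
    have hd := hM.dist_le_mul _ (mem_image_of_mem u hp) _ (mem_image_of_mem u hq)
    rw [Real.dist_eq, Real.dist_eq] at hd
    have hle := (abs_le.1 hd).2
    have hMnn : (0:ℝ) ≤ M := M.2
    have h1 : (M + 1 : ℝ)⁻¹ * (f (u p) - f (u q)) ≤ (M + 1 : ℝ)⁻¹ * (M * |u p - u q|) := by gcongr
    have h2 : (M + 1 : ℝ)⁻¹ * M ≤ 1 := by rw [inv_mul_le_iff₀ hlam]; linarith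
    have h3 : 0 ≤ (M + 1 : ℝ)⁻¹ * M := by positivity
    rcases le_total (u p) (u q) with h | h
    · rw [max_eq_left (by linarith)]
      rw [abs_of_nonpos (by linarith)] at h1
      nlinarith
    · rw [max_eq_right (by linarith)]
      rw [abs_of_nonneg (by linarith)] at h1
      nlinarith

/-- Monotonicity of solutions to the autonomous Volterra equation
`u(t) = u₀ + ∫₀ᵗ a(t−s) f(u(s)) ds` with a completely positive kernel `a`: an
absolutely continuous solution on `[0, T_b)` is nondecreasing if `f(u₀) ≥ 0` and
nonincreasing if `f(u₀) ≤ 0`. -/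
theorem autonomous_volterra_monotone
    (T Tb : ℝ) (hT : 0 < T) (hTb : 0 < Tb) (hTbT : Tb ≤ T)
    (a : ℝ → ℝ) (haInt : IntegrableOn a (Ioc 0 T))
    (hacp : CompletelyPositive a T)
    (f : ℝ → ℝ) (hf : ContDiff ℝ 1 f)
    (u₀ : ℝ) (u : ℝ → ℝ)
    (huc : ContinuousOn u (Ico 0 Tb))
    (huAC : ∃ u' : ℝ → ℝ,
      (∀ t ∈ Ico (0:ℝ) Tb, IntervalIntegrable u' volume 0 t) ∧
      ∀ t ∈ Ico (0:ℝ) Tb, u t = u 0 + ∫ s in (0:ℝ)..t, u' s)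
    (hu : ∀ t ∈ Ico (0:ℝ) Tb, u t = u₀ + ∫ s in (0:ℝ)..t, a (t - s) * f (u s)) :
    (0 ≤ f u₀ → MonotoneOn u (Ico 0 Tb)) ∧
    (f u₀ ≤ 0 → AntitoneOn u (Ico 0 Tb)) := by
  have hlip := hf.locallyLipschitz
  refine ⟨fun h => hacp.monotoneOn_of_volterra hTbT haInt hlip huc hu h, fun h => ?_⟩
  have hneg : LocallyLipschitz fun x => -f (-x) :=
    (hf.comp contDiff_neg).neg.locallyLipschitz
  have hmono := hacp.monotoneOn_of_volterra (u := fun t => -u t) (u₀ := -u₀) hTbT haInt hneg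
    huc.neg (fun t ht => by simp only [hu t ht, neg_neg, mul_neg,
      intervalIntegral.integral_neg]; ring) (by simpa using h)
  simpa using hmono.neg
end

section
/- Let 0 < α < 1 and let s₁ < s₂ < s₃ ≤ T₁ < T₂ be real numbers. Then [(T₂ − s₁)^α − (T₂ − s₂)^α]·[(T₁ − s₂)^α − (T₁ − s₃)^α] ≥ [(T₁ − s₁)^α − (T₁ − s₂)^α]·[(T₂ − s₂)^α − (T₂ − s₃)^α]. Equivalently, the ratio [(T₂ − s)^α − (T₂ − s')^α]/[(T₁ − s)^α − (T₁ − s')^α] over consecutive mesh intervals (s, s') is nonincreasing as the interval moves to the right. -/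
/-- Cauchy's mean value theorem for a power function and its translate by `δ`. -/
theorem exists_shifted_rpow_sub_eq_mul {α a b δ : ℝ} (hα : 0 < α) (ha : 0 ≤ a) (hab : a < b)
    (hδ : 0 ≤ δ) :
    ∃ c ∈ Set.Ioo a b,
      (b + δ) ^ α - (a + δ) ^ α = ((c + δ) / c) ^ (α - 1) * (b ^ α - a ^ α) := by
  have hcont : Continuous fun x : ℝ => x ^ α := Real.continuous_rpow_const hα.le
  obtain ⟨c, hc, h⟩ := exists_ratio_hasDerivAt_eq_ratio_slope
    (fun x : ℝ => (x + δ) ^ α) (fun x => α * (x + δ) ^ (α - 1)) hab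
    (hcont.comp (continuous_add_const δ)).continuousOn
    (fun x hx => by
      have hx0 : x + δ ≠ 0 := by linarith [hx.1]
      simpa using (Real.hasDerivAt_rpow_const (p := α) (Or.inl hx0)).comp_add_const x δ)
    (fun x : ℝ => x ^ α) (fun x => α * x ^ (α - 1)) hcont.continuousOn
    (fun x hx => Real.hasDerivAt_rpow_const (Or.inl (ha.trans_lt hx.1).ne'))
  have hc0 : 0 < c := ha.trans_lt hc.1
  have hpos : 0 < c ^ (α - 1) := Real.rpow_pos_of_pos hc0 _
  refine ⟨c, hc, ?_⟩
  rw [Real.div_rpow (by linarith) hc0.le, div_mul_eq_mul_div, eq_div_iff hpos.ne']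
  apply mul_left_cancel₀ hα.ne'
  linear_combination -h

/-- The key log-convexity inequality for the averaged-integral kernel of the fractional
integral of order `α ∈ (0,1)`: the ratio
`[(T₂ − s)^α − (T₂ − s')^α] / [(T₁ − s)^α − (T₁ − s')^α]` over consecutive mesh
intervals `(s, s')` is nonincreasing as the interval moves to the right. -/
theorem averaged_kernel_logconvex_step1
    (α : ℝ) (hα0 : 0 < α) (hα1 : α < 1)
    (s₁ s₂ s₃ T₁ T₂ : ℝ)
    (h12 : s₁ < s₂) (h23 : s₂ < s₃) (h3T : s₃ ≤ T₁) (hTT : T₁ < T₂) :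
    ((T₁ - s₁) ^ α - (T₁ - s₂) ^ α) * ((T₂ - s₂) ^ α - (T₂ - s₃) ^ α) ≤
      ((T₂ - s₁) ^ α - (T₂ - s₂) ^ α) * ((T₁ - s₂) ^ α - (T₁ - s₃) ^ α) := by
  obtain ⟨c, hc, hc'⟩ := exists_shifted_rpow_sub_eq_mul (a := T₁ - s₂) (b := T₁ - s₁)
    (δ := T₂ - T₁) hα0 (by linarith) (by linarith) (by linarith)
  obtain ⟨d, hd, hd'⟩ := exists_shifted_rpow_sub_eq_mul (a := T₁ - s₃) (b := T₁ - s₂)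
    (δ := T₂ - T₁) hα0 (by linarith) (by linarith) (by linarith)
  have hshift (s : ℝ) : T₁ - s + (T₂ - T₁) = T₂ - s := by ring
  simp only [hshift] at hc' hd'
  have hd0 : 0 < d := by linarith [hd.1]
  have hdc : d ≤ c := (hd.2.trans hc.1).le
  have hc0 : 0 < c := hd0.trans_le hdc
  have hratio : (c + (T₂ - T₁)) / c ≤ (d + (T₂ - T₁)) / d := by
    rw [div_le_div_iff₀ hc0 hd0]
    nlinarith
  have hpow : ((d + (T₂ - T₁)) / d) ^ (α - 1) ≤ ((c + (T₂ - T₁)) / c) ^ (α - 1) :=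
    Real.rpow_le_rpow_of_nonpos (div_pos (by linarith) hc0) hratio (by linarith)
  have hA : 0 ≤ (T₁ - s₁) ^ α - (T₁ - s₂) ^ α :=
    sub_nonneg.2 (Real.rpow_le_rpow (by linarith) (by linarith) hα0.le)
  have hB : 0 ≤ (T₁ - s₂) ^ α - (T₁ - s₃) ^ α :=
    sub_nonneg.2 (Real.rpow_le_rpow (by linarith) (by linarith) hα0.le)
  rw [hc', hd']
  linarith [mul_le_mul_of_nonneg_right hpow (mul_nonneg hA hB)]
end

section
/- Let 0 < α < 1 and let s₂ < s₁ ≤ T₁ < T₂ < T₃ be real numbers. Then [(T₂ − s₁)^α − (T₁ − s₁)^α]·[(T₃ − s₂)^α − (T₂ − s₂)^α] ≥ [(T₂ − s₂)^α − (T₁ − s₂)^α]·[(T₃ − s₁)^α − (T₂ − s₁)^α]. Equivalently, the ratio [(T' − s₁)^α − (T − s₁)^α]/[(T' − s₂)^α − (T − s₂)^α] over consecutive time levels (T, T') is nonincreasing as the time levels move to the right. -/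
/-- Cauchy's mean value theorem for two translates of the power function `t ↦ t ^ α`. -/
theorem exists_rpow_sub_eq_ratio_rpow_mul {α p q a b : ℝ} (hα : 0 < α)
    (hqp : q < p) (hpa : p ≤ a) (hab : a < b) :
    ∃ c ∈ Set.Ioo a b, (b - p) ^ α - (a - p) ^ α =
      ((c - p) / (c - q)) ^ (α - 1) * ((b - q) ^ α - (a - q) ^ α) := by
  have hcont (s : ℝ) : ContinuousOn (fun t : ℝ => (t - s) ^ α) (Set.Icc a b) :=
    ((continuous_id.sub continuous_const).rpow_const fun _ => Or.inr hα.le).continuousOn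
  have hderiv (s : ℝ) (hs : s ≤ a) (t : ℝ) (ht : t ∈ Set.Ioo a b) :
      HasDerivAt (fun t : ℝ => (t - s) ^ α) (α * (t - s) ^ (α - 1)) t := by
    have hts : t - s ≠ 0 := (sub_pos.2 (hs.trans_lt ht.1)).ne'
    simpa using ((hasDerivAt_id t).sub_const s).rpow_const (p := α) (Or.inl hts)
  obtain ⟨c, hc, h⟩ := exists_ratio_hasDerivAt_eq_ratio_slope _ _ hab (hcont p) (hderiv p hpa)
    _ _ (hcont q) (hderiv q (hqp.le.trans hpa))
  have hcp : 0 < c - p := sub_pos.2 (hpa.trans_lt hc.1)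
  have hcq : 0 < c - q := by linarith
  have hpow : 0 < (c - q) ^ (α - 1) := Real.rpow_pos_of_pos hcq _
  refine ⟨c, hc, ?_⟩
  rw [Real.div_rpow hcp.le hcq.le, div_mul_eq_mul_div, eq_div_iff hpow.ne']
  apply mul_left_cancel₀ hα.ne'
  linear_combination -h


/-- The key log-convexity inequality (Step 2) for the averaged-integral kernel of the
fractional integral of order `α ∈ (0,1)`: the ratio
`[(T' − s₁)^α − (T − s₁)^α] / [(T' − s₂)^α − (T − s₂)^α]` over consecutive time levels
`(T, T')` is nonincreasing as the time levels move to the right. -/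
theorem averaged_kernel_logconvex_step2
    (α : ℝ) (hα0 : 0 < α) (hα1 : α < 1)
    (s₂ s₁ T₁ T₂ T₃ : ℝ)
    (h21 : s₂ < s₁) (h1T : s₁ ≤ T₁) (hT12 : T₁ < T₂) (hT23 : T₂ < T₃) :
    ((T₂ - s₂) ^ α - (T₁ - s₂) ^ α) * ((T₃ - s₁) ^ α - (T₂ - s₁) ^ α) ≤
      ((T₂ - s₁) ^ α - (T₁ - s₁) ^ α) * ((T₃ - s₂) ^ α - (T₂ - s₂) ^ α) := by
  obtain ⟨c, hc, hfc⟩ := exists_rpow_sub_eq_ratio_rpow_mul hα0 h21 h1T hT12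
  obtain ⟨d, hd, hfd⟩ := exists_rpow_sub_eq_ratio_rpow_mul hα0 h21 (h1T.trans hT12.le) hT23
  have hcs : 0 < c - s₁ := sub_pos.2 (h1T.trans_lt hc.1)
  have hcd : c < d := hc.2.trans hd.1
  have hcs' : 0 < c - s₂ := by linarith
  have hds' : 0 < d - s₂ := by linarith
  have hquot : (c - s₁) / (c - s₂) ≤ (d - s₁) / (d - s₂) := by
    rw [div_le_div_iff₀ hcs' hds']
    nlinarith [mul_pos (sub_pos.2 hcd) (sub_pos.2 h21)]
  have hratio : ((d - s₁) / (d - s₂)) ^ (α - 1) ≤ ((c - s₁) / (c - s₂)) ^ (α - 1) :=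
    Real.rpow_le_rpow_of_nonpos (div_pos hcs hcs') hquot (by linarith)
  have hg₁ : 0 ≤ (T₂ - s₂) ^ α - (T₁ - s₂) ^ α :=
    sub_nonneg.2 (Real.rpow_le_rpow (by linarith) (by linarith) hα0.le)
  have hg₂ : 0 ≤ (T₃ - s₂) ^ α - (T₂ - s₂) ^ α :=
    sub_nonneg.2 (Real.rpow_le_rpow (by linarith) (by linarith) hα0.le)
  rw [hfc, hfd]
  linarith [mul_le_mul_of_nonneg_right hratio (mul_nonneg hg₁ hg₂)]
end
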